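/- Let n = 4 and let T₁, T₂ ∈ 𝒯̃. Then there exists V ∈ SPAN(𝒯̃) such that ΔV(x) = T₁(x)·T₂(x) for all x ∈ ℝ⁴ with x ≠ 0. -/

import Mathlib

open Real
open scoped BigOperators

noncomputable section

abbrev E (n : ℕ) := EuclideanSpace ℝ (Fin n)

/-- The Euclidean Laplacian of `f` at `x` (sum of second partial derivatives). -/
def lap (n : ℕ) (f : E n → ℝ) (x : E n) : ℝ :=
  ∑ i : Fin n, fderiv ℝ (fun y => fderiv ℝ f y (EuclideanSpace.single i 1)) x
    (EuclideanSpace.single i 1)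

/-- `f` is a (real) polynomial function on `ℝⁿ`. -/
def IsPolyFun (n : ℕ) (f : E n → ℝ) : Prop :=
  ∃ P : MvPolynomial (Fin n) ℝ, ∀ x : E n, f x = MvPolynomial.eval (fun i => x i) P

/-- `p` is a harmonic homogeneous polynomial of degree `m` on `ℝⁿ`. -/
def IsHHP (n m : ℕ) (p : E n → ℝ) : Prop :=
  IsPolyFun n p ∧ (∀ (c : ℝ) (x : E n), p (c • x) = c ^ m * p x) ∧ ∀ x : E n, lap n p x = 0

/-- The set `𝒯̃` on `ℝ⁴`. -/
def Ttilde : Set (E 4 → ℝ) :=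
  {f | ∃ (l k i m : ℕ) (p : E 4 → ℝ), IsHHP 4 m p ∧ 1 ≤ l ∧ l + i ≤ k ∧ m ≤ k ∧
    Even (k - m) ∧
    f = fun x => ‖x‖ ^ (-(2 * (l:ℝ)) - k - m) * (Real.log ‖x‖) ^ i * p x}

namespace MvPolynomial

variable {n : ℕ}

/-- The algebraic Laplacian on real polynomials in `n` variables. -/
def laplacian (P : MvPolynomial (Fin n) ℝ) : MvPolynomial (Fin n) ℝ :=
  ∑ i, pderiv i (pderiv i P)

/-- The polynomial `∑ Xᵢ²`. -/
def sqNorm (n : ℕ) : MvPolynomial (Fin n) ℝ := ∑ i, X i ^ 2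

theorem laplacian_add (P Q : MvPolynomial (Fin n) ℝ) :
    laplacian (P + Q) = laplacian P + laplacian Q := by
  simp [laplacian, Finset.sum_add_distrib]

theorem laplacian_smul (c : ℝ) (P : MvPolynomial (Fin n) ℝ) :
    laplacian (c • P) = c • laplacian P := by
  simp [laplacian, Finset.smul_sum]

theorem IsHomogeneous.laplacian {P : MvPolynomial (Fin n) ℝ} {d : ℕ}
    (hP : P.IsHomogeneous (d + 2)) : (laplacian P).IsHomogeneous d :=
  IsHomogeneous.sum _ _ _ fun i _ => (hP.pderiv (i := i)).pderiv (i := i)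

theorem IsHomogeneous.laplacian_eq_zero {P : MvPolynomial (Fin n) ℝ} {d : ℕ}
    (hP : P.IsHomogeneous d) (hd : d < 2) : MvPolynomial.laplacian P = 0 := by
  refine Finset.sum_eq_zero fun i _ => ?_
  have h : (pderiv i P).IsHomogeneous 0 := by
    have := hP.pderiv (i := i)
    rwa [show d - 1 = 0 by omega] at this
  rw [← totalDegree_zero_iff_isHomogeneous, totalDegree_eq_zero_iff_eq_C] at h
  rw [h, pderiv_C]

theorem isHomogeneous_sqNorm : (sqNorm n).IsHomogeneous 2 :=
  IsHomogeneous.sum _ _ _ fun i _ => isHomogeneous_X_pow i 2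

theorem pderiv_sqNorm (i : Fin n) : pderiv i (sqNorm n) = 2 * X i := by
  classical
  simp [sqNorm, pderiv_X, Pi.single_apply]

theorem laplacian_sqNorm_mul {Q : MvPolynomial (Fin n) ℝ} {d : ℕ} (hQ : Q.IsHomogeneous d) :
    laplacian (sqNorm n * Q) = (2 * n + 4 * d : ℝ) • Q + sqNorm n * laplacian Q := by
  have h2 (i : Fin n) : pderiv i (2 : MvPolynomial (Fin n) ℝ) = 0 := by
    rw [← map_ofNat C 2, pderiv_C]
  have h (i : Fin n) : pderiv i (pderiv i (sqNorm n * Q)) =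
      2 * Q + 4 * (X i * pderiv i Q) + sqNorm n * pderiv i (pderiv i Q) := by
    simp only [pderiv_mul, pderiv_sqNorm, map_add, h2, pderiv_X_self]
    ring
  simp only [laplacian, h, Finset.sum_add_distrib, ← Finset.mul_sum, hQ.sum_X_mul_pderiv]
  simp only [Finset.sum_const, Finset.card_univ, Fintype.card_fin, nsmul_eq_mul, smul_eq_C_mul,
    C_add, C_mul, map_natCast, map_ofNat]
  ring

theorem exists_laplacian_sqNorm_pow_mul (hn : 0 < n) {H : MvPolynomial (Fin n) ℝ} {m : ℕ}
    (hH : H.IsHomogeneous m) (h0 : laplacian H = 0) (j : ℕ) :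
    ∃ c : ℝ, 0 < c ∧ laplacian (sqNorm n ^ (j + 1) * H) = c • (sqNorm n ^ j * H) := by
  have hn' : (0 : ℝ) < n := by exact_mod_cast hn
  induction j with
  | zero =>
    refine ⟨2 * n + 4 * m, by positivity, ?_⟩
    simp [laplacian_sqNorm_mul hH, h0]
  | succ j ih =>
    obtain ⟨c, hc, h⟩ := ih
    refine ⟨2 * n + 4 * (2 * (j + 1) + m : ℕ) + c, by positivity, ?_⟩
    rw [pow_succ' _ (j + 1), mul_assoc,
      laplacian_sqNorm_mul ((isHomogeneous_sqNorm.pow (j + 1)).mul hH), h, mul_smul_comm,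
      ← mul_assoc, ← pow_succ', add_smul _ c]

/-- The products `(∑ Xᵢ²)ʲ H` of degree `d` with `H` harmonic and homogeneous. -/
def harmonicMultiples (n d : ℕ) : Set (MvPolynomial (Fin n) ℝ) :=
  {P | ∃ (j m : ℕ) (H : MvPolynomial (Fin n) ℝ), 2 * j + m = d ∧ H.IsHomogeneous m ∧
    laplacian H = 0 ∧ P = sqNorm n ^ j * H}

theorem sqNorm_mul_mem_span_harmonicMultiples {d : ℕ} {Q : MvPolynomial (Fin n) ℝ}
    (hQ : Q ∈ Submodule.span ℝ (harmonicMultiples n d)) :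
    sqNorm n * Q ∈ Submodule.span ℝ (harmonicMultiples n (d + 2)) := by
  induction hQ using Submodule.span_induction with
  | mem P hP =>
    obtain ⟨j, m, H, hd, hH, h0, rfl⟩ := hP
    exact Submodule.subset_span ⟨j + 1, m, H, by omega, hH, h0, by rw [pow_succ', mul_assoc]⟩
  | zero => simp
  | add P Q _ _ hP hQ => rw [mul_add]; exact add_mem hP hQ
  | smul c P _ hP => rw [mul_smul_comm]; exact Submodule.smul_mem _ c hP

theorem isHomogeneous_of_mem_span_harmonicMultiples {d : ℕ} {Q : MvPolynomial (Fin n) ℝ}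
    (hQ : Q ∈ Submodule.span ℝ (harmonicMultiples n d)) : Q.IsHomogeneous d := by
  rw [← mem_homogeneousSubmodule]
  refine Submodule.span_le.2 ?_ hQ
  rintro _ ⟨j, m, H, rfl, hH, -, rfl⟩
  exact (isHomogeneous_sqNorm.pow j).mul hH

theorem exists_laplacian_sqNorm_mul_eq (hn : 0 < n) {d : ℕ} {P : MvPolynomial (Fin n) ℝ}
    (hP : P ∈ Submodule.span ℝ (harmonicMultiples n d)) :
    ∃ Q ∈ Submodule.span ℝ (harmonicMultiples n d), laplacian (sqNorm n * Q) = P := by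
  induction hP using Submodule.span_induction with
  | mem P hP =>
    obtain ⟨j, m, H, hd, hH, h0, rfl⟩ := hP
    obtain ⟨c, hc, h⟩ := exists_laplacian_sqNorm_pow_mul hn hH h0 j
    refine ⟨c⁻¹ • (sqNorm n ^ j * H),
      Submodule.smul_mem _ _ (Submodule.subset_span ⟨j, m, H, hd, hH, h0, rfl⟩), ?_⟩
    rw [mul_smul_comm, ← mul_assoc, ← pow_succ', laplacian_smul, h, inv_smul_smul₀ hc.ne']
  | zero => exact ⟨0, zero_mem _, by simp [laplacian]⟩
  | add P Q _ _ hP hQ =>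
    obtain ⟨P', hP', rfl⟩ := hP
    obtain ⟨Q', hQ', rfl⟩ := hQ
    exact ⟨P' + Q', add_mem hP' hQ', by rw [mul_add, laplacian_add]⟩
  | smul c P _ hP =>
    obtain ⟨P', hP', rfl⟩ := hP
    exact ⟨c • P', Submodule.smul_mem _ c hP', by rw [mul_smul_comm, laplacian_smul]⟩

/-- Every homogeneous polynomial is a sum of products of powers of `∑ Xᵢ²` with harmonic
homogeneous polynomials. -/
theorem IsHomogeneous.mem_span_harmonicMultiples (hn : 0 < n) {d : ℕ}
    {P : MvPolynomial (Fin n) ℝ} (hP : P.IsHomogeneous d) :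
    P ∈ Submodule.span ℝ (harmonicMultiples n d) := by
  induction d using Nat.strong_induction_on generalizing P with
  | _ d ih =>
    by_cases hd : d < 2
    · exact Submodule.subset_span ⟨0, d, P, by simp, hP, hP.laplacian_eq_zero hd, by simp⟩
    obtain ⟨e, rfl⟩ : ∃ e, d = e + 2 := ⟨d - 2, by omega⟩
    obtain ⟨Q, hQ, hPQ⟩ := exists_laplacian_sqNorm_mul_eq hn (ih e (by omega) hP.laplacian)
    have hQ2 := sqNorm_mul_mem_span_harmonicMultiples hQ
    have hharm : P - sqNorm n * Q ∈ harmonicMultiples n (e + 2) := by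
      refine ⟨0, e + 2, P - sqNorm n * Q, by simp,
        hP.sub (isHomogeneous_of_mem_span_harmonicMultiples hQ2), ?_, by simp⟩
      rw [sub_eq_add_neg, ← neg_one_smul ℝ, laplacian_add, laplacian_smul, hPQ]
      simp
    have := add_mem (Submodule.subset_span (R := ℝ) hharm) hQ2
    rwa [sub_add_cancel] at this

theorem coeff_bind₁_C_mul_X {σ R : Type*} [CommSemiring R] (c : R) (P : MvPolynomial σ R)
    (d : σ →₀ ℕ) : (bind₁ (fun i => C c * X i) P).coeff d = c ^ d.degree * P.coeff d := by
  classical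
  induction P using MvPolynomial.induction_on' with
  | monomial e a =>
    have : bind₁ (fun i => C c * X i) (monomial e a) = C (c ^ e.degree) * monomial e a := by
      rw [bind₁_monomial, monomial_eq, Finsupp.degree_apply]
      simp only [mul_pow, Finset.prod_mul_distrib, Finsupp.prod, Finset.prod_pow_eq_pow_sum, C_pow]
      ring
    rw [this, coeff_C_mul, coeff_monomial]
    split_ifs with h
    · rw [h]
    · simp
  | add P Q hP hQ => simp [hP, hQ, mul_add]

theorem eval_bind₁_C_mul_X (c : ℝ) (x : Fin n → ℝ) (P : MvPolynomial (Fin n) ℝ) :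
    eval x (bind₁ (fun i => C c * X i) P) = eval (c • x) P := by
  have h := aeval_bind₁ x (fun i => C c * X i) P
  have hx : (fun i => aeval x (C c * X i : MvPolynomial (Fin n) ℝ)) = c • x := by
    ext i
    simp
  rwa [hx] at h

theorem isHomogeneous_of_eval_smul {m : ℕ} {P : MvPolynomial (Fin n) ℝ}
    (h : ∀ (c : ℝ) (x : Fin n → ℝ), eval (c • x) P = c ^ m * eval x P) : P.IsHomogeneous m := by
  have hP : bind₁ (fun i => C 2 * X i) P = C (2 ^ m) * P := by
    refine MvPolynomial.funext fun x => ?_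
    rw [eval_mul, eval_C, ← h, eval_bind₁_C_mul_X]
  intro d hd
  have h' := congrArg (coeff d) hP
  rw [coeff_bind₁_C_mul_X, coeff_C_mul] at h'
  have hdm := pow_right_injective₀ (a := (2 : ℝ)) (by norm_num) (by norm_num)
    (mul_right_cancel₀ hd h')
  exact (DFunLike.congr_fun Finsupp.degree_eq_weight_one d).symm.trans hdm

theorem IsHomogeneous.eval_smul {m : ℕ} {P : MvPolynomial (Fin n) ℝ} (hP : P.IsHomogeneous m)
    (c : ℝ) (x : Fin n → ℝ) : eval (c • x) P = c ^ m * eval x P := by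
  have h : bind₁ (fun i => C c * X i) P = C (c ^ m) * P := by
    ext d
    rw [coeff_bind₁_C_mul_X, coeff_C_mul]
    by_cases hd : P.coeff d = 0
    · simp [hd]
    · rw [by_contra fun h => hd (hP.coeff_eq_zero h)]
  rw [← eval_bind₁_C_mul_X, h, eval_mul, eval_C]

end MvPolynomial

section Calculus

open MvPolynomial Topology

variable {n : ℕ}

theorem contDiff_eval (P : MvPolynomial (Fin n) ℝ) {k : WithTop ℕ∞} :
    ContDiff ℝ k (fun x : E n => eval (fun i => x i) P) := by
  induction P using MvPolynomial.induction_on with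
  | C a => simpa using contDiff_const
  | add P Q hP hQ => simpa using hP.add hQ
  | mul_X P i hP =>
    have hi : ContDiff ℝ k (fun x : E n => x i) := (EuclideanSpace.proj (𝕜 := ℝ) i).contDiff
    simpa using hP.mul hi

theorem fderiv_eval_single (P : MvPolynomial (Fin n) ℝ) (x : E n) (i : Fin n) :
    fderiv ℝ (fun y : E n => eval (fun i => y i) P) x (EuclideanSpace.single i 1) =
      eval (fun i => x i) (pderiv i P) := by
  induction P using MvPolynomial.induction_on with
  | C a => simp
  | add P Q hP hQ =>
    have hdP := ((contDiff_eval P (k := 1)).differentiable (by simp)) x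
    have hdQ := ((contDiff_eval Q (k := 1)).differentiable (by simp)) x
    simp only [map_add]
    rw [fderiv_fun_add hdP hdQ, ← hP, ← hQ]
    rfl
  | mul_X P j hP =>
    have hdP := ((contDiff_eval P (k := 1)).differentiable (by simp)) x
    have hj : HasFDerivAt (fun y : E n => y j) (EuclideanSpace.proj (𝕜 := ℝ) j) x :=
      (EuclideanSpace.proj (𝕜 := ℝ) j).hasFDerivAt
    simp only [eval_mul, eval_X, pderiv_mul, map_add]
    rw [(hdP.hasFDerivAt.fun_mul hj).fderiv, ← hP]
    classical
    by_cases hij : j = i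
    · subst hij; simp; ring
    · simp [pderiv_X_of_ne hij, hij]; ring

theorem lap_eval (P : MvPolynomial (Fin n) ℝ) (x : E n) :
    lap n (fun y => eval (fun i => y i) P) x = eval (fun i => x i) (laplacian P) := by
  simp only [lap, fderiv_eval_single, laplacian, map_sum]

theorem lap_congr {f g : E n → ℝ} {x : E n} (h : f =ᶠ[𝓝 x] g) : lap n f x = lap n g x := by
  refine Finset.sum_congr rfl fun i _ => ?_
  rw [Filter.EventuallyEq.fderiv_eq]
  filter_upwards [h.eventuallyEq_nhds] with y hy
  rw [hy.fderiv_eq]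

theorem differentiableAt_fderiv_apply {f : E n → ℝ} {x : E n} (hf : ContDiffAt ℝ 2 f x)
    (v : E n) : DifferentiableAt ℝ (fun y => fderiv ℝ f y v) x :=
  ((hf.fderiv_right (m := 1) (by norm_num)).clm_apply contDiffAt_const).differentiableAt (by simp)

theorem eventually_differentiableAt {f : E n → ℝ} {x : E n} (hf : ContDiffAt ℝ 2 f x) :
    ∀ᶠ y in 𝓝 x, DifferentiableAt ℝ f y :=
  (hf.eventually (by simp)).mono fun _ h => h.differentiableAt (by simp)

theorem lap_add {f g : E n → ℝ} {x : E n} (hf : ContDiffAt ℝ 2 f x) (hg : ContDiffAt ℝ 2 g x) :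
    lap n (f + g) x = lap n f x + lap n g x := by
  simp only [lap, ← Finset.sum_add_distrib]
  refine Finset.sum_congr rfl fun i _ => ?_
  have h : (fun y => fderiv ℝ (f + g) y (EuclideanSpace.single i 1)) =ᶠ[𝓝 x]
      (fun y => fderiv ℝ f y (EuclideanSpace.single i 1)) +
        fun y => fderiv ℝ g y (EuclideanSpace.single i 1) := by
    filter_upwards [eventually_differentiableAt hf, eventually_differentiableAt hg] with y h1 h2
    rw [fderiv_add h1 h2]
    rfl
  rw [h.fderiv_eq, fderiv_add (differentiableAt_fderiv_apply hf _)
    (differentiableAt_fderiv_apply hg _)]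
  rfl

theorem lap_smul (c : ℝ) {f : E n → ℝ} {x : E n} (hf : ContDiffAt ℝ 2 f x) :
    lap n (c • f) x = c * lap n f x := by
  simp only [lap, Finset.mul_sum]
  refine Finset.sum_congr rfl fun i _ => ?_
  have h : (fun y => fderiv ℝ (c • f) y (EuclideanSpace.single i 1)) =ᶠ[𝓝 x]
      c • fun y => fderiv ℝ f y (EuclideanSpace.single i 1) := by
    filter_upwards [eventually_differentiableAt hf] with y h1
    rw [fderiv_const_smul h1]
    rfl
  rw [h.fderiv_eq, fderiv_const_smul (differentiableAt_fderiv_apply hf _)]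
  rfl

theorem fderiv_radial_mul_eval {g : ℝ → ℝ} {g' : ℝ} {x : E n} (hg : HasDerivAt g g' (‖x‖ ^ 2))
    (P : MvPolynomial (Fin n) ℝ) (i : Fin n) :
    fderiv ℝ (fun y : E n => g (‖y‖ ^ 2) * eval (fun i => y i) P) x (EuclideanSpace.single i 1) =
      g' * (2 * x i) * eval (fun i => x i) P + g (‖x‖ ^ 2) * eval (fun i => x i) (pderiv i P) := by
  have hP := ((contDiff_eval P (k := 1)).differentiable (by simp) x).hasFDerivAt
  have hr := hg.comp_hasFDerivAt x (hasStrictFDerivAt_norm_sq x).hasFDerivAt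
  refine (congrArg (fun L => L (EuclideanSpace.single i 1)) (hr.fun_mul hP).fderiv).trans ?_
  rw [← fderiv_eval_single]
  simp [EuclideanSpace.inner_single_right]
  ring

theorem differentiableAt_radial_mul_eval {g : ℝ → ℝ} {g' : ℝ} {x : E n}
    (hg : HasDerivAt g g' (‖x‖ ^ 2)) (P : MvPolynomial (Fin n) ℝ) :
    DifferentiableAt ℝ (fun y : E n => g (‖y‖ ^ 2) * eval (fun i => y i) P) x :=
  (hg.comp_hasFDerivAt x (hasStrictFDerivAt_norm_sq x).hasFDerivAt).differentiableAt.mul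
    ((contDiff_eval P (k := 1)).differentiable (by simp) x)

theorem lap_radial_mul_eval {g g₁ g₂ : ℝ → ℝ} (h₁ : ∀ t > 0, HasDerivAt g (g₁ t) t)
    (h₂ : ∀ t > 0, HasDerivAt g₁ (g₂ t) t) {P : MvPolynomial (Fin n) ℝ} {m : ℕ}
    (hP : P.IsHomogeneous m) (h0 : laplacian P = 0) {x : E n} (hx : x ≠ 0) :
    lap n (fun y => g (‖y‖ ^ 2) * eval (fun i => y i) P) x =
      (4 * ‖x‖ ^ 2 * g₂ (‖x‖ ^ 2) + (2 * n + 4 * m) * g₁ (‖x‖ ^ 2)) *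
        eval (fun i => x i) P := by
  have hpos {y : E n} (hy : y ≠ 0) : 0 < ‖y‖ ^ 2 := by positivity
  have hsecond (i : Fin n) :
      fderiv ℝ (fun y => fderiv ℝ (fun y : E n => g (‖y‖ ^ 2) * eval (fun i => y i) P) y
        (EuclideanSpace.single i 1)) x (EuclideanSpace.single i 1) =
      4 * g₂ (‖x‖ ^ 2) * eval (fun i => x i) P * x i ^ 2 +
        2 * g₁ (‖x‖ ^ 2) * eval (fun i => x i) P +
        4 * g₁ (‖x‖ ^ 2) * (x i * eval (fun i => x i) (pderiv i P)) +
        g (‖x‖ ^ 2) * eval (fun i => x i) (pderiv i (pderiv i P)) := by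
    have hfirst : (fun y => fderiv ℝ (fun y : E n => g (‖y‖ ^ 2) * eval (fun i => y i) P) y
        (EuclideanSpace.single i 1)) =ᶠ[𝓝 x]
        (fun y : E n => g₁ (‖y‖ ^ 2) * eval (fun i => y i) (C 2 * X i * P)) +
          fun y : E n => g (‖y‖ ^ 2) * eval (fun i => y i) (pderiv i P) := by
      filter_upwards [isOpen_ne.mem_nhds hx] with y hy
      rw [fderiv_radial_mul_eval (h₁ _ (hpos hy))]
      simp
      ring
    rw [hfirst.fderiv_eq, fderiv_add (differentiableAt_radial_mul_eval (h₂ _ (hpos hx)) _)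
      (differentiableAt_radial_mul_eval (h₁ _ (hpos hx)) _), add_apply,
      fderiv_radial_mul_eval (h₂ _ (hpos hx)), fderiv_radial_mul_eval (h₁ _ (hpos hx))]
    simp only [eval_mul, eval_C, eval_X, pderiv_mul, pderiv_C, pderiv_X_self, map_add, map_zero,
      map_one]
    ring
  have heuler : ∑ i, x i * eval (fun i => x i) (pderiv i P) = m * eval (fun i => x i) P := by
    have := congrArg (eval fun i => x i) hP.sum_X_mul_pderiv
    simpa using this
  have hlap : ∑ i, eval (fun i => x i) (pderiv i (pderiv i P)) = 0 := by
    rw [← map_sum]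
    exact (congrArg (eval fun i => x i) h0).trans (map_zero _)
  simp only [lap, hsecond, Finset.sum_add_distrib, ← Finset.mul_sum, heuler, hlap,
    ← EuclideanSpace.real_norm_sq_eq]
  simp only [Finset.sum_const, Finset.card_univ, Fintype.card_fin, nsmul_eq_mul]
  ring

theorem isHHP_eval {m : ℕ} {P : MvPolynomial (Fin n) ℝ} (hP : P.IsHomogeneous m)
    (h0 : laplacian P = 0) : IsHHP n m (fun x => eval (fun i => x i) P) := by
  refine ⟨⟨P, fun _ => rfl⟩, fun c x => hP.eval_smul c _, fun x => ?_⟩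
  rw [lap_eval, h0, map_zero]

theorem IsHHP.exists_isHomogeneous {m : ℕ} {p : E n → ℝ} (hp : IsHHP n m p) :
    ∃ P : MvPolynomial (Fin n) ℝ, P.IsHomogeneous m ∧ p = fun x => eval (fun i => x i) P := by
  obtain ⟨⟨P, hP⟩, hhom, -⟩ := hp
  refine ⟨P, isHomogeneous_of_eval_smul fun c x => ?_, funext hP⟩
  have := hhom c (WithLp.toLp 2 x)
  rwa [hP, hP] at this

end Calculus

section Solvability

open MvPolynomial Topology

/-- The function `t ↦ tᵇ (log t / 2)ⁱ`. -/
def rpowLog (b : ℝ) (i : ℕ) (t : ℝ) : ℝ := t ^ b * (Real.log t / 2) ^ i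

theorem hasDerivAt_rpowLog (b : ℝ) (i : ℕ) {t : ℝ} (ht : 0 < t) :
    HasDerivAt (rpowLog b i) (b * rpowLog (b - 1) i t + i / 2 * rpowLog (b - 1) (i - 1) t) t := by
  have h := (Real.hasDerivAt_rpow_const (p := b) (Or.inl ht.ne')).fun_mul
    (((Real.hasDerivAt_log ht.ne').div_const 2).fun_pow i)
  refine h.congr_deriv ?_
  rw [rpowLog, rpowLog, Real.rpow_sub_one ht.ne']
  ring

theorem mul_rpowLog_sub_one (b : ℝ) (i : ℕ) {t : ℝ} (ht : 0 < t) :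
    t * rpowLog (b - 1) i t = rpowLog b i t := by
  rw [rpowLog, rpowLog, Real.rpow_sub_one ht.ne']
  field_simp

theorem rpowLog_norm_sq {n : ℕ} (s : ℝ) (i : ℕ) (x : E n) :
    rpowLog (s / 2) i (‖x‖ ^ 2) = ‖x‖ ^ s * Real.log ‖x‖ ^ i := by
  rw [rpowLog, ← Real.rpow_natCast_mul (norm_nonneg x), Real.log_pow]
  congr 2 <;> push_cast <;> ring

/-- The function `x ↦ |x|ˢ (log |x|)ⁱ P(x)`. -/
def normRpowLogMul (s : ℝ) (i : ℕ) (P : MvPolynomial (Fin 4) ℝ) (x : E 4) : ℝ :=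
  ‖x‖ ^ s * Real.log ‖x‖ ^ i * eval (fun i => x i) P

theorem lap_normRpowLogMul (s : ℝ) (i : ℕ) {P : MvPolynomial (Fin 4) ℝ} {m : ℕ}
    (hP : P.IsHomogeneous m) (h0 : laplacian P = 0) {x : E 4} (hx : x ≠ 0) :
    lap 4 (normRpowLogMul s i P) x =
      s * (s + 2 + 2 * m) * normRpowLogMul (s - 2) i P x +
        i * (2 * s + 2 + 2 * m) * normRpowLogMul (s - 2) (i - 1) P x +
        i * (i - 1 : ℕ) * normRpowLogMul (s - 2) (i - 2) P x := by
  have hfun : normRpowLogMul s i P =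
      fun y : E 4 => rpowLog (s / 2) i (‖y‖ ^ 2) * eval (fun i => y i) P :=
    funext fun y => by rw [normRpowLogMul, rpowLog_norm_sq]
  have ht : 0 < ‖x‖ ^ 2 := by positivity
  have hred (j : ℕ) : ‖x‖ ^ 2 * rpowLog (s / 2 - 1 - 1) j (‖x‖ ^ 2) =
      rpowLog (s / 2 - 1) j (‖x‖ ^ 2) := mul_rpowLog_sub_one _ j ht
  rw [hfun, lap_radial_mul_eval (fun t ht => hasDerivAt_rpowLog (s / 2) i ht)
    (fun t ht => ((hasDerivAt_rpowLog (s / 2 - 1) i ht).const_mul (s / 2)).add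
      ((hasDerivAt_rpowLog (s / 2 - 1) (i - 1) ht).const_mul (i / 2 : ℝ))) hP h0 hx]
  simp only [normRpowLogMul, ← rpowLog_norm_sq, show (s - 2) / 2 = s / 2 - 1 by ring,
    show i - 2 = i - 1 - 1 by omega]
  rw [← hred, ← hred (i - 1), ← hred (i - 1 - 1)]
  push_cast
  ring

theorem normRpowLogMul_mem_Ttilde {l k i m : ℕ} {P : MvPolynomial (Fin 4) ℝ}
    (hP : P.IsHomogeneous m) (h0 : laplacian P = 0) (hl : 1 ≤ l) (hi : l + i ≤ k) (hm : m ≤ k)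
    (he : Even (k - m)) : normRpowLogMul (-(2 * (l : ℝ)) - k - m) i P ∈ Ttilde :=
  ⟨l, k, i, m, _, isHHP_eval hP h0, hl, hi, hm, he, rfl⟩

theorem contDiffAt_of_mem_span_Ttilde {V : E 4 → ℝ} (hV : V ∈ Submodule.span ℝ Ttilde) {x : E 4}
    (hx : x ≠ 0) : ContDiffAt ℝ 2 V x := by
  induction hV using Submodule.span_induction with
  | mem V hV =>
    obtain ⟨l, k, i, m, p, ⟨⟨P, hP⟩, -⟩, -, -, -, -, rfl⟩ := hV
    have hn : ContDiffAt ℝ 2 (fun y : E 4 => ‖y‖) x := contDiffAt_norm ℝ hx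
    have hx' : ‖x‖ ≠ 0 := norm_ne_zero_iff.2 hx
    rw [funext hP]
    exact ((hn.rpow_const_of_ne hx').mul ((hn.log hx').pow i)).mul (contDiff_eval P).contDiffAt
  | zero => exact contDiffAt_const
  | add V W _ _ hV hW => exact hV.add hW
  | smul c V _ hV => exact contDiffAt_const.smul hV

/-- The right-hand sides `f` for which `ΔV = f` on `ℝ⁴ ∖ {0}` has a solution in the span of
`Ttilde`. -/
def solvable : Submodule ℝ (E 4 → ℝ) where
  carrier := {f | ∃ V ∈ Submodule.span ℝ Ttilde, ∀ x : E 4, x ≠ 0 → lap 4 V x = f x}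
  zero_mem' := ⟨0, zero_mem _, fun x _ => by simp [lap]⟩
  add_mem' := by
    rintro f g ⟨V, hV, hf⟩ ⟨W, hW, hg⟩
    refine ⟨V + W, add_mem hV hW, fun x hx => ?_⟩
    rw [lap_add (contDiffAt_of_mem_span_Ttilde hV hx) (contDiffAt_of_mem_span_Ttilde hW hx),
      hf x hx, hg x hx, Pi.add_apply]
  smul_mem' := by
    rintro c f ⟨V, hV, hf⟩
    refine ⟨c • V, Submodule.smul_mem _ c hV, fun x hx => ?_⟩
    rw [lap_smul c (contDiffAt_of_mem_span_Ttilde hV hx), hf x hx, Pi.smul_apply, smul_eq_mul]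

theorem solvable_congr {f g : E 4 → ℝ} (hf : f ∈ solvable) (h : ∀ x, x ≠ 0 → f x = g x) :
    g ∈ solvable := by
  obtain ⟨V, hV, hVf⟩ := hf
  exact ⟨V, hV, fun x hx => (hVf x hx).trans (h x hx)⟩

theorem normRpowLogMul_mem_solvable {l k i m : ℕ} {P : MvPolynomial (Fin 4) ℝ}
    (hP : P.IsHomogeneous m) (h0 : laplacian P = 0) (hl : 1 ≤ l) (hi : l + 1 + i ≤ k)
    (hm : m ≤ k) (he : Even (k - m)) :
    normRpowLogMul (-(2 * (l : ℝ)) - k - m - 2) i P ∈ solvable := by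
  induction i using Nat.strong_induction_on with
  | _ i ih =>
    set s : ℝ := -(2 * (l : ℝ)) - k - m with hs
    have hl' : (1 : ℝ) ≤ l := by exact_mod_cast hl
    have hmk : (m : ℝ) ≤ k := by exact_mod_cast hm
    have hm0 : (0 : ℝ) ≤ m := m.cast_nonneg
    have hs0 : s ≠ 0 := by intro h; linarith
    have hlower (j : ℕ) (c : ℝ) (hc : i ≤ j → c = 0) :
        c • normRpowLogMul (s - 2) j P ∈ solvable := by
      by_cases hj : i ≤ j
      · simp [hc hj]
      · exact Submodule.smul_mem _ _ (ih j (by omega) (by omega))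
    have hsource (j : ℕ) (hj : l + j ≤ k) :
        (s * (s + 2 + 2 * m)) • normRpowLogMul (s - 2) j P +
          ((j : ℝ) * (2 * s + 2 + 2 * m)) • normRpowLogMul (s - 2) (j - 1) P +
          ((j : ℝ) * (j - 1 : ℕ)) • normRpowLogMul (s - 2) (j - 2) P ∈ solvable :=
      ⟨_, Submodule.subset_span (normRpowLogMul_mem_Ttilde hP h0 hl hj hm he),
        fun x hx => lap_normRpowLogMul s j hP h0 hx⟩
    by_cases hres : s + 2 + 2 * m = 0
    · have h := hsource (i + 1) (by omega)
      rw [hres, mul_zero, zero_smul, zero_add, Nat.add_sub_cancel] at h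
      have h' := (Submodule.add_mem_iff_left _ (hlower (i + 1 - 2) _ fun hi => by
        obtain rfl : i = 0 := by omega
        simp)).1 h
      refine (Submodule.smul_mem_iff _ (mul_ne_zero (by positivity) ?_)).1 h'
      rwa [show 2 * s + 2 + 2 * (m : ℝ) = s by linarith]
    · have h := hsource i (by omega)
      rw [Submodule.add_mem_iff_left _ (hlower (i - 2) _ fun hi => by
          obtain rfl : i = 0 := by omega
          simp),
        Submodule.add_mem_iff_left _ (hlower (i - 1) _ fun hi => by
          obtain rfl : i = 0 := by omega
          simp)] at h
      exact (Submodule.smul_mem_iff _ (mul_ne_zero hs0 hres)).1 h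

theorem normRpowLogMul_mem_solvable_of_isHomogeneous {l k i d : ℕ}
    {P : MvPolynomial (Fin 4) ℝ} (hP : P.IsHomogeneous d) (hl : 2 ≤ l) (hi : l + i ≤ k)
    (hd : d ≤ k) (he : Even (k - d)) :
    normRpowLogMul (-(2 * (l : ℝ)) - k - d) i P ∈ solvable := by
  have hspan := hP.mem_span_harmonicMultiples (by norm_num)
  clear hP
  induction hspan using Submodule.span_induction with
  | mem P hP =>
    obtain ⟨j, m, H, rfl, hH, h0, rfl⟩ := hP
    obtain ⟨l, rfl⟩ : ∃ l', l = l' + 1 := ⟨l - 1, by omega⟩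
    have hkm : Even (k - m) := by
      rw [show k - m = k - (2 * j + m) + 2 * j by omega]
      exact he.add (even_two_mul j)
    refine solvable_congr (normRpowLogMul_mem_solvable (i := i) hH h0 (by omega : 1 ≤ l) hi
      (by omega) hkm) fun x hx => ?_
    have hx' : 0 < ‖x‖ := norm_pos_iff.2 hx
    have hsq : eval (fun i => x i) (sqNorm 4) = ‖x‖ ^ 2 := by
      rw [EuclideanSpace.real_norm_sq_eq, sqNorm, map_sum]
      simp
    rw [normRpowLogMul, normRpowLogMul, eval_mul, eval_pow, hsq, ← pow_mul,
      show -(2 * (l : ℝ)) - k - m - 2 =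
        -(2 * ((l + 1 : ℕ) : ℝ)) - k - (2 * j + m : ℕ) + (2 * j : ℕ) by push_cast; ring,
      Real.rpow_add_natCast hx'.ne']
    ring
  | zero => exact solvable_congr (zero_mem _) fun x _ => by simp [normRpowLogMul]
  | add P Q _ _ hP hQ =>
    exact solvable_congr (add_mem hP hQ) fun x _ => by simp [normRpowLogMul, mul_add]
  | smul c P _ hP =>
    exact solvable_congr (Submodule.smul_mem _ c hP) fun x _ => by
      simp [normRpowLogMul, mul_left_comm]

end Solvability

/-- for `n = 4`, `ΔV = T₁·T₂` (`T₁, T₂ ∈ 𝒯̃`) has a solution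
`V ∈ SPAN(𝒯̃)` on `ℝ⁴∖{0}`. -/
theorem poisson_product_solvable_dim4 (T₁ T₂ : E 4 → ℝ)
    (h₁ : T₁ ∈ Ttilde) (h₂ : T₂ ∈ Ttilde) :
    ∃ V ∈ Submodule.span ℝ Ttilde, ∀ x : E 4, x ≠ 0 →
      lap 4 V x = T₁ x * T₂ x := by
  obtain ⟨l₁, k₁, i₁, m₁, p₁, hp₁, hl₁, hi₁, hm₁, he₁, rfl⟩ := h₁
  obtain ⟨l₂, k₂, i₂, m₂, p₂, hp₂, hl₂, hi₂, hm₂, he₂, rfl⟩ := h₂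
  obtain ⟨P₁, hP₁, rfl⟩ := hp₁.exists_isHomogeneous
  obtain ⟨P₂, hP₂, rfl⟩ := hp₂.exists_isHomogeneous
  have he : Even (k₁ + k₂ - (m₁ + m₂)) := by
    rw [show k₁ + k₂ - (m₁ + m₂) = k₁ - m₁ + (k₂ - m₂) by omega]
    exact he₁.add he₂
  refine solvable_congr (normRpowLogMul_mem_solvable_of_isHomogeneous (l := l₁ + l₂)
    (i := i₁ + i₂) (hP₁.mul hP₂) (by omega) (by omega) (by omega) he) fun x hx => ?_
  rw [normRpowLogMul, MvPolynomial.eval_mul, pow_add,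
    show -(2 * ((l₁ + l₂ : ℕ) : ℝ)) - (k₁ + k₂ : ℕ) - (m₁ + m₂ : ℕ) =
      (-(2 * (l₁ : ℝ)) - k₁ - m₁) + (-(2 * (l₂ : ℝ)) - k₂ - m₂) by push_cast; ring,
    Real.rpow_add (norm_pos_iff.2 hx)]
  ring
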